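/- Let α, β ∈ (0, 2/9). There exists c_{α,β} > 0 such that for every c with 0 < c < c_{α,β} the following holds: if f : ℝ → ℂ is an even, real-valued Schwartz function satisfying f(c·n^α) = 0 for every n ∈ ℕ and f̂(c·n^β) = 0 for every n ∈ ℕ (including n = 0 in both cases), then f ≡ 0. -/

import Mathlib

open MeasureTheory FourierTransform Real

/-- Power functions with exponent at most `1 / 2` have increments bounded by the inverse of the
value at the right endpoint. -/
lemma natCast_rpow_mul_sub_le_one {a : ℝ} (ha : 0 < a) (ha' : a ≤ 1 / 2) (n : ℕ) :
    ((n + 1 : ℕ) : ℝ) ^ a * (((n + 1 : ℕ) : ℝ) ^ a - (n : ℝ) ^ a) ≤ 1 := by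
  have hn : (0 : ℝ) ≤ n := n.cast_nonneg
  have hsub := Real.rpow_add_le_add_rpow hn zero_le_one (p := a + a) (by linarith) (by linarith)
  rw [Real.one_rpow, Real.rpow_add_of_nonneg hn ha.le ha.le,
    Real.rpow_add_of_nonneg (by linarith) ha.le ha.le] at hsub
  have hmono : (n : ℝ) ^ a ≤ ((n : ℝ) + 1) ^ a := Real.rpow_le_rpow hn (by linarith) ha.le
  have hpos : (0 : ℝ) ≤ (n : ℝ) ^ a := Real.rpow_nonneg hn a
  push_cast
  nlinarith

/-- The Cauchy–Schwarz inequality against the constant function `1` on an interval. -/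
lemma sq_intervalIntegral_le {g : ℝ → ℝ} (hg : Continuous g) {a b : ℝ} (hab : a ≤ b) :
    (∫ x in a..b, g x) ^ 2 ≤ (b - a) * ∫ x in a..b, g x ^ 2 := by
  rcases hab.eq_or_lt with rfl | hlt
  · simp
  set S := ∫ x in a..b, g x with hS
  have hl : 0 < b - a := sub_pos.2 hlt
  have hnn : 0 ≤ ∫ x in a..b, ((b - a) * g x - S) ^ 2 :=
    intervalIntegral.integral_nonneg hab fun x _ => sq_nonneg _
  have hexp : ∫ x in a..b, ((b - a) * g x - S) ^ 2
      = (b - a) ^ 2 * (∫ x in a..b, g x ^ 2) - (b - a) * S ^ 2 := by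
    have hpt : ∀ x, ((b - a) * g x - S) ^ 2
        = (b - a) ^ 2 * g x ^ 2 - 2 * (b - a) * S * g x + S ^ 2 := fun x => by ring
    simp_rw [hpt]
    rw [intervalIntegral.integral_add, intervalIntegral.integral_sub,
      intervalIntegral.integral_const_mul, intervalIntegral.integral_const_mul, ← hS,
      intervalIntegral.integral_const, smul_eq_mul]
    · ring
    all_goals exact Continuous.intervalIntegrable (by fun_prop) _ _
  rw [hexp] at hnn
  have : 0 ≤ (b - a) * ((b - a) * (∫ x in a..b, g x ^ 2) - S ^ 2) := by linarith
  linarith [nonneg_of_mul_nonneg_right this hl]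

/-- A weighted Poincaré inequality on an interval at whose left endpoint the function vanishes. -/
lemma intervalIntegral_sq_mul_norm_sq_le {f : ℝ → ℂ} (hf : ContDiff ℝ 1 f) {a b k : ℝ}
    (ha : 0 ≤ a) (hab : a ≤ b) (hk : b * (b - a) ≤ k) (hfa : f a = 0) :
    ∫ x in a..b, x ^ 2 * ‖f x‖ ^ 2 ≤ k ^ 2 * ∫ x in a..b, ‖deriv f x‖ ^ 2 := by
  have hc : Continuous f := hf.continuous
  have hd : Continuous (deriv f) := hf.continuous_deriv le_rfl
  set D := ∫ x in a..b, ‖deriv f x‖ ^ 2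
  have hD : 0 ≤ D := intervalIntegral.integral_nonneg hab fun x _ => sq_nonneg _
  have hpt : ∀ x ∈ Set.Icc a b, x ^ 2 * ‖f x‖ ^ 2 ≤ b ^ 2 * ((b - a) * D) := by
    rintro x ⟨hax, hxb⟩
    have hftc : ∫ y in a..x, deriv f y = f x - f a :=
      intervalIntegral.integral_deriv_eq_sub
        (fun y _ => (hf.differentiable one_ne_zero).differentiableAt) (hd.intervalIntegrable _ _)
    have hle : ‖f x‖ ≤ ∫ y in a..b, ‖deriv f y‖ := by
      calc ‖f x‖ = ‖∫ y in a..x, deriv f y‖ := by rw [hftc, hfa, sub_zero]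
        _ ≤ ∫ y in a..x, ‖deriv f y‖ := intervalIntegral.norm_integral_le_integral_norm hax
        _ ≤ ∫ y in a..b, ‖deriv f y‖ :=
          intervalIntegral.integral_mono_interval le_rfl hax hxb
            (Filter.Eventually.of_forall fun y => norm_nonneg _) (hd.norm.intervalIntegrable _ _)
    have hsq : ‖f x‖ ^ 2 ≤ (b - a) * D :=
      (pow_le_pow_left₀ (norm_nonneg _) hle 2).trans (sq_intervalIntegral_le hd.norm hab)
    have hx : 0 ≤ x := ha.trans hax
    gcongr
  have hb : 0 ≤ b * (b - a) := mul_nonneg (ha.trans hab) (sub_nonneg.2 hab)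
  calc ∫ x in a..b, x ^ 2 * ‖f x‖ ^ 2
      ≤ ∫ _ in a..b, b ^ 2 * ((b - a) * D) :=
        intervalIntegral.integral_mono_on hab (Continuous.intervalIntegrable (by fun_prop) _ _)
          (by simp) hpt
    _ = (b * (b - a)) ^ 2 * D := by
        rw [intervalIntegral.integral_const, smul_eq_mul]
        ring
    _ ≤ k ^ 2 * D := by gcongr

/-- The weighted Poincaré inequality on the half-line, for functions vanishing on a sequence with
small gaps. -/
lemma integral_Ioi_sq_mul_norm_sq_le {f : ℝ → ℂ} (hf : ContDiff ℝ 1 f)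
    (hxf : Integrable fun x : ℝ => x ^ 2 * ‖f x‖ ^ 2) (hdf : Integrable fun x => ‖deriv f x‖ ^ 2)
    {t : ℕ → ℝ} {k : ℝ} (ht0 : t 0 = 0) (htm : Monotone t)
    (htop : Filter.Tendsto t Filter.atTop Filter.atTop)
    (hk : ∀ n, t (n + 1) * (t (n + 1) - t n) ≤ k) (hft : ∀ n, f (t n) = 0) :
    ∫ x in Set.Ioi (0 : ℝ), x ^ 2 * ‖f x‖ ^ 2
      ≤ k ^ 2 * ∫ x in Set.Ioi (0 : ℝ), ‖deriv f x‖ ^ 2 := by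
  have hfin : ∀ n, ∫ x in (0 : ℝ)..t n, x ^ 2 * ‖f x‖ ^ 2
      ≤ k ^ 2 * ∫ x in (0 : ℝ)..t n, ‖deriv f x‖ ^ 2 := by
    intro n
    induction n with
    | zero => simp [ht0]
    | succ n ih =>
      have hstep := intervalIntegral_sq_mul_norm_sq_le hf (ht0 ▸ htm n.zero_le) (htm n.le_succ)
        (hk n) (hft n)
      rw [← intervalIntegral.integral_add_adjacent_intervals
          (hxf.intervalIntegrable (a := 0) (b := t n)) hxf.intervalIntegrable,
        ← intervalIntegral.integral_add_adjacent_intervals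
          (hdf.intervalIntegrable (a := 0) (b := t n)) hdf.intervalIntegrable, mul_add]
      exact add_le_add ih hstep
  exact le_of_tendsto_of_tendsto' (intervalIntegral_tendsto_integral_Ioi 0 hxf.integrableOn htop)
    ((intervalIntegral_tendsto_integral_Ioi 0 hdf.integrableOn htop).const_mul _) hfin

lemma integral_eq_two_mul_integral_Ioi_of_even {g : ℝ → ℝ} (hg : ∀ x, g (-x) = g x) :
    ∫ x, g x = 2 * ∫ x in Set.Ioi (0 : ℝ), g x := by
  rw [← integral_comp_abs]
  congr with x
  rcases abs_choice x with h | h <;> simp [h, hg]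

namespace SchwartzMap

lemma integrable_norm_sq (f : SchwartzMap ℝ ℂ) : Integrable fun x => ‖f x‖ ^ 2 :=
  MemLp.integrable_norm_pow (p := 2) (f.memLp 2) two_ne_zero

lemma integrable_sq_mul_norm_sq (f : SchwartzMap ℝ ℂ) :
    Integrable fun x : ℝ => x ^ 2 * ‖f x‖ ^ 2 := by
  have hg : Function.HasTemperateGrowth (fun x : ℝ => x) := by fun_prop
  convert! (smulLeftCLM ℂ (fun x : ℝ => x) f).integrable_norm_sq using 2 with x
  rw [smulLeftCLM_apply hg, norm_smul, mul_pow, norm_eq_abs, sq_abs]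

lemma integral_norm_deriv_sq (f : SchwartzMap ℝ ℂ) :
    ∫ x, ‖deriv f x‖ ^ 2 = 4 * π ^ 2 * ∫ ξ : ℝ, ξ ^ 2 * ‖𝓕 f ξ‖ ^ 2 := by
  have h := (derivCLM ℂ ℂ f).integral_norm_sq_fourier
  have hderiv : ⇑(derivCLM ℂ ℂ f) = deriv f := funext fun x => derivCLM_apply ℂ f x
  have hint : Integrable (deriv f) := hderiv ▸ (derivCLM ℂ ℂ f).integrable
  rw [fourier_coe, hderiv, Real.fourier_deriv f.integrable f.differentiable hint] at h
  rw [← h, ← integral_const_mul]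
  congr with ξ
  rw [fourier_coe, norm_smul, mul_pow]
  simp [abs_of_pos pi_pos, mul_pow]
  ring

/-- If an even Schwartz function vanishes on a sequence with small gaps, its second moment is
controlled by that of its Fourier transform. -/
lemma integral_sq_mul_norm_sq_le (f : SchwartzMap ℝ ℂ) (hf : ∀ x, f (-x) = f x)
    {t : ℕ → ℝ} {k : ℝ} (ht0 : t 0 = 0) (htm : Monotone t)
    (htop : Filter.Tendsto t Filter.atTop Filter.atTop)
    (hk : ∀ n, t (n + 1) * (t (n + 1) - t n) ≤ k) (hft : ∀ n, f (t n) = 0) :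
    ∫ x : ℝ, x ^ 2 * ‖f x‖ ^ 2 ≤ 4 * π ^ 2 * k ^ 2 * ∫ ξ : ℝ, ξ ^ 2 * ‖𝓕 f ξ‖ ^ 2 := by
  have hdint : Integrable fun x => ‖deriv f x‖ ^ 2 := by
    simpa only [derivCLM_apply] using (derivCLM ℂ ℂ f).integrable_norm_sq
  have hdeven : ∀ x, ‖deriv f (-x)‖ ^ 2 = ‖deriv f x‖ ^ 2 := fun x => by
    have h := deriv_comp_neg f x
    simp_rw [hf] at h
    rw [h, norm_neg]
  have hmain := integral_Ioi_sq_mul_norm_sq_le (f.smooth 1) f.integrable_sq_mul_norm_sq hdint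
    ht0 htm htop hk hft
  have hd := f.integral_norm_deriv_sq
  rw [integral_eq_two_mul_integral_Ioi_of_even hdeven] at hd
  rw [integral_eq_two_mul_integral_Ioi_of_even fun x => by simp [hf]]
  linarith [congrArg (k ^ 2 * ·) hd]

lemma fourier_neg_of_even (f : SchwartzMap ℝ ℂ) (hf : ∀ x, f (-x) = f x) (ξ : ℝ) :
    𝓕 f (-ξ) = 𝓕 f ξ := by
  have h := Real.fourier_comp_linearIsometry (LinearIsometryEquiv.neg ℝ (E := ℝ)) f ξ
  have hcomp : ⇑f ∘ ⇑(LinearIsometryEquiv.neg ℝ (E := ℝ)) = f := funext fun x => by simp [hf]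
  rw [hcomp] at h
  simpa [fourier_coe] using h.symm

lemma fourier_fourier_of_even (f : SchwartzMap ℝ ℂ) (hf : ∀ x, f (-x) = f x) : 𝓕 (𝓕 f) = f := by
  ext x
  have h : 𝓕⁻ (𝓕 f) = f := FourierTransform.fourierInv_fourier_eq f
  rw [← fourier_neg_of_even _ (f.fourier_neg_of_even hf), fourier_coe,
    ← Real.fourierInv_eq_fourier_neg, ← fourierInv_coe, h]

lemma eq_zero_of_integral_sq_mul_norm_sq_eq_zero (f : SchwartzMap ℝ ℂ)
    (hf : ∫ x : ℝ, x ^ 2 * ‖f x‖ ^ 2 = 0) (hf0 : f 0 = 0) (x : ℝ) : f x = 0 := by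
  have hc := f.continuous
  rw [integral_eq_zero_iff_of_nonneg (fun x => by positivity) f.integrable_sq_mul_norm_sq,
    Continuous.ae_eq_iff_eq volume (by fun_prop) continuous_zero] at hf
  have hx : x ^ 2 * ‖f x‖ ^ 2 = 0 := congrFun hf x
  rcases mul_eq_zero.1 hx with h | h
  · rw [pow_eq_zero_iff two_ne_zero] at h
    rw [h, hf0]
  · simpa using h

end SchwartzMap

theorem stmt8 (α β : ℝ) (hα : α ∈ Set.Ioo (0 : ℝ) (2/9)) (hβ : β ∈ Set.Ioo (0 : ℝ) (2/9)) :
    ∃ cαβ : ℝ, 0 < cαβ ∧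
      ∀ c : ℝ, 0 < c → c < cαβ →
        ∀ f : SchwartzMap ℝ ℂ,
          (∀ x : ℝ, f (-x) = f x) →            -- f is even
          (∀ x : ℝ, (f x).im = 0) →            -- f is real-valued
          (∀ n : ℕ, f (c * (n : ℝ) ^ α) = 0) →
          (∀ n : ℕ, 𝓕 (⇑f) (c * (n : ℝ) ^ β) = 0) →
          ∀ x : ℝ, f x = 0 := by
  refine ⟨1 / 3, by norm_num, fun c hc hc3 f hf _ hfα hfβ => ?_⟩
  have key : ∀ a ∈ Set.Ioo (0 : ℝ) (2 / 9), ∀ g : SchwartzMap ℝ ℂ, (∀ x, g (-x) = g x) →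
      (∀ n : ℕ, g (c * (n : ℝ) ^ a) = 0) →
      ∫ x : ℝ, x ^ 2 * ‖g x‖ ^ 2
        ≤ 4 * π ^ 2 * (c ^ 2) ^ 2 * ∫ ξ : ℝ, ξ ^ 2 * ‖𝓕 g ξ‖ ^ 2 := by
    rintro a ⟨ha, ha'⟩ g hg hga
    refine g.integral_sq_mul_norm_sq_le hg (t := fun n : ℕ => c * (n : ℝ) ^ a) ?_ ?_ ?_ ?_ hga
    · simp [Real.zero_rpow ha.ne']
    · intro m n hmn
      dsimp only
      gcongr
    · exact ((tendsto_rpow_atTop ha).comp tendsto_natCast_atTop_atTop).const_mul_atTop hc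
    · intro n
      have h := natCast_rpow_mul_sub_le_one ha (by linarith) n
      have := mul_le_mul_of_nonneg_left h (sq_nonneg c)
      linarith
  have hA := key α hα f hf hfα
  have hB := key β hβ (𝓕 f) (f.fourier_neg_of_even hf) hfβ
  rw [f.fourier_fourier_of_even hf] at hB
  have hlt : 4 * π ^ 2 * (c ^ 2) ^ 2 < 1 := by
    have hpi : π ^ 2 < 3.15 ^ 2 := pow_lt_pow_left₀ pi_lt_d2 pi_pos.le two_ne_zero
    have hc4 : (c ^ 2) ^ 2 < ((1 / 3) ^ 2) ^ 2 := by gcongr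
    nlinarith [sq_nonneg (c ^ 2), sq_nonneg π]
  have hA0 : 0 ≤ ∫ x : ℝ, x ^ 2 * ‖f x‖ ^ 2 := integral_nonneg fun x => by positivity
  have hB0 : 0 ≤ ∫ x : ℝ, x ^ 2 * ‖𝓕 f x‖ ^ 2 := integral_nonneg fun x => by positivity
  refine f.eq_zero_of_integral_sq_mul_norm_sq_eq_zero ?_ ?_
  · nlinarith
  · simpa [Real.zero_rpow hα.1.ne'] using hfα 0
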